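/- arXiv:1604.06954 — 3 statements merged into one kernel-verified Lean document; each statement's English description precedes it below -/
import Mathlib

section
/- The downward refinement operator ρ_t⪯ defined by the rewrite rules R0PO, R1PO, R2PO, R3PO, R4PO, R5PO, and R6PO is locally finite and complete for the quasi-ordered set (G, ⊑→⪯), where ⊑→⪯ is trans-subsumption relative to the partial order ⪯ on labels. -/
/-- A directed labeled graph (DLG) over a label type `L`, with vertices drawn from `ℕ`:
a finite vertex set `V`, a finite edge set `E ⊆ V × V`, and labeling functions for
vertices and edges. -/
structure DLG (L : Type) where
  V : Finset ℕ
  E : Finset (ℕ × ℕ)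
  lv : ℕ → L
  le : ℕ × ℕ → L
  edge_mem : ∀ e ∈ E, e.1 ∈ V ∧ e.2 ∈ V

namespace DLG

variable {L : Type}

/-- Undirected adjacency: there is an edge between `v` and `w` in either direction. -/
def adj (g : DLG L) (v w : ℕ) : Prop :=
  (v, w) ∈ g.E ∨ (w, v) ∈ g.E

/-- A DLG is connected when any two of its vertices are joined by an undirected path. -/
def Connected (g : DLG L) : Prop :=
  ∀ v ∈ g.V, ∀ w ∈ g.V, Relation.ReflTransGen g.adj v w

/-- A canonical fresh vertex not belonging to `g.V`. -/
def fresh (g : DLG L) : ℕ := g.V.sup id + 1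

/-- The graph obtained by deleting the edge `e`. -/
def removeEdge (g : DLG L) (e : ℕ × ℕ) : DLG L where
  V := g.V
  E := g.E.erase e
  lv := g.lv
  le := g.le
  edge_mem := fun e' he' => g.edge_mem e' (Finset.mem_of_mem_erase he')

/-- An edge `e ∈ E` is a bridge of `g` when removing it leaves a disconnected graph. -/
def IsBridge (g : DLG L) (e : ℕ × ℕ) : Prop :=
  e ∈ g.E ∧ ¬ (g.removeEdge e).Connected

/-- The set of edges of `g` incident to the vertex `v`. -/
def incident (g : DLG L) (v : ℕ) : Finset (ℕ × ℕ) :=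
  g.E.filter fun e => e.1 = v ∨ e.2 = v

/-! ### Subsumption relations -/

/-- `m` witnesses that `g₁` subsumes `g₂` (regular subsumption). -/
def SubsWith (g₁ g₂ : DLG L) (m : ℕ → ℕ) : Prop :=
  (∀ v ∈ g₁.V, m v ∈ g₂.V) ∧
  (∀ e ∈ g₁.E, (m e.1, m e.2) ∈ g₂.E) ∧
  (∀ v ∈ g₁.V, g₁.lv v = g₂.lv (m v)) ∧
  (∀ e ∈ g₁.E, g₁.le e = g₂.le (m e.1, m e.2))

/-- Regular subsumption `g₁ ⊑ g₂`. -/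
def Subs (g₁ g₂ : DLG L) : Prop := ∃ m, SubsWith g₁ g₂ m

/-- The object-identity constraint on a vertex mapping: injectivity on `g₁.V`. -/
def OI (g₁ : DLG L) (m : ℕ → ℕ) : Prop :=
  ∀ v₁ ∈ g₁.V, ∀ v₂ ∈ g₁.V, v₁ ≠ v₂ → m v₁ ≠ m v₂

/-- Regular subsumption under object identity. -/
def SubsOI (g₁ g₂ : DLG L) : Prop := ∃ m, SubsWith g₁ g₂ m ∧ OI g₁ m

/-- `m` and `me` witness that `g₁` trans-subsumes `g₂`: each edge of `g₁` is mapped to a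
sequence of consecutive edges of `g₂` (given by the list of vertices `me e`), all carrying
the label of the original edge. -/
def TransSubsWith (g₁ g₂ : DLG L) (m : ℕ → ℕ) (me : ℕ × ℕ → List ℕ) : Prop :=
  (∀ v ∈ g₁.V, m v ∈ g₂.V) ∧
  (∀ v ∈ g₁.V, g₁.lv v = g₂.lv (m v)) ∧
  (∀ e ∈ g₁.E,
    2 ≤ (me e).length ∧
    (me e).head? = some (m e.1) ∧
    (me e).getLast? = some (m e.2) ∧
    (me e).Chain' fun a b => (a, b) ∈ g₂.E ∧ g₂.le (a, b) = g₁.le e)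

/-- Trans-subsumption `g₁ ⊑→ g₂`. -/
def TransSubs (g₁ g₂ : DLG L) : Prop := ∃ m me, TransSubsWith g₁ g₂ m me

/-- The object-identity constraint for trans-subsumption: `m` is injective on `g₁.V`, and
no vertex of `g₁` other than the endpoints of an edge `e` of `g₁` is mapped into the
path `me e`. -/
def TransOI (g₁ : DLG L) (m : ℕ → ℕ) (me : ℕ × ℕ → List ℕ) : Prop :=
  OI g₁ m ∧ ∀ v ∈ g₁.V, ∀ e ∈ g₁.E, v ≠ e.1 → v ≠ e.2 → m v ∉ me e

/-- Trans-subsumption under object identity. -/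
def TransSubsOI (g₁ g₂ : DLG L) : Prop :=
  ∃ m me, TransSubsWith g₁ g₂ m me ∧ TransOI g₁ m me

section OrderLabeled

variable [PartialOrder L]

/-- `m` witnesses subsumption relative to the partial order `≤` (i.e. `⪯`) on labels. -/
def SubsPOWith (g₁ g₂ : DLG L) (m : ℕ → ℕ) : Prop :=
  (∀ v ∈ g₁.V, m v ∈ g₂.V) ∧
  (∀ e ∈ g₁.E, (m e.1, m e.2) ∈ g₂.E) ∧
  (∀ v ∈ g₁.V, g₁.lv v ≤ g₂.lv (m v)) ∧
  (∀ e ∈ g₁.E, g₁.le e ≤ g₂.le (m e.1, m e.2))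

/-- Subsumption relative to `⪯`: `g₁ ⊑⪯ g₂`. -/
def SubsPO (g₁ g₂ : DLG L) : Prop := ∃ m, SubsPOWith g₁ g₂ m

/-- Subsumption relative to `⪯` under object identity. -/
def SubsPOOI (g₁ g₂ : DLG L) : Prop := ∃ m, SubsPOWith g₁ g₂ m ∧ OI g₁ m

/-- `m` and `me` witness trans-subsumption relative to `⪯`. -/
def TransSubsPOWith (g₁ g₂ : DLG L) (m : ℕ → ℕ) (me : ℕ × ℕ → List ℕ) : Prop :=
  (∀ v ∈ g₁.V, m v ∈ g₂.V) ∧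
  (∀ v ∈ g₁.V, g₁.lv v ≤ g₂.lv (m v)) ∧
  (∀ e ∈ g₁.E,
    2 ≤ (me e).length ∧
    (me e).head? = some (m e.1) ∧
    (me e).getLast? = some (m e.2) ∧
    (me e).Chain' fun a b => (a, b) ∈ g₂.E ∧ g₁.le e ≤ g₂.le (a, b))

/-- Trans-subsumption relative to `⪯`: `g₁ ⊑→⪯ g₂`. -/
def TransSubsPO (g₁ g₂ : DLG L) : Prop := ∃ m me, TransSubsPOWith g₁ g₂ m me

/-- Trans-subsumption relative to `⪯` under object identity. -/
def TransSubsPOOI (g₁ g₂ : DLG L) : Prop :=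
  ∃ m me, TransSubsPOWith g₁ g₂ m me ∧ TransOI g₁ m me

end OrderLabeled

/-! ### Refinement operators for flat-labeled DLGs -/

/-- The downward refinement operator `ρ_f`, given by rewrite rules R0, R1, R2, R3. -/
def rho_f (g : DLG L) : Set (DLG L) :=
  {g' |
    -- R0: add a single vertex (labeled `a`) to the empty graph
    (g.V = ∅ ∧ g.E = ∅ ∧ ∃ a : L,
      g'.V = {g.fresh} ∧ g'.E = ∅ ∧
      g'.lv = Function.update g.lv g.fresh a ∧ g'.le = g.le) ∨
    -- R1: add a new vertex `v*` labeled `a` with outgoing edge `(v*, v₁)` labeled `b`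
    (∃ v₁ ∈ g.V, ∃ a b : L,
      g'.V = insert g.fresh g.V ∧
      g'.E = insert (g.fresh, v₁) g.E ∧
      g'.lv = Function.update g.lv g.fresh a ∧
      g'.le = Function.update g.le (g.fresh, v₁) b) ∨
    -- R2: add a new vertex `v*` labeled `a` with incoming edge `(v₁, v*)` labeled `b`
    (∃ v₁ ∈ g.V, ∃ a b : L,
      g'.V = insert g.fresh g.V ∧
      g'.E = insert (v₁, g.fresh) g.E ∧
      g'.lv = Function.update g.lv g.fresh a ∧
      g'.le = Function.update g.le (v₁, g.fresh) b) ∨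
    -- R3: add an edge `(v₁, v₂)` labeled `a`
    (∃ v₁ ∈ g.V, ∃ v₂ ∈ g.V, (v₁, v₂) ∉ g.E ∧ ∃ a : L,
      g'.V = g.V ∧
      g'.E = insert (v₁, v₂) g.E ∧
      g'.lv = g.lv ∧
      g'.le = Function.update g.le (v₁, v₂) a)}

/-- The downward refinement operator `ρ_tf`, given by rules R0–R3 together with the
split-edge rule R4. -/
def rho_tf (g : DLG L) : Set (DLG L) :=
  rho_f g ∪
  -- R4: split an edge `e` by a new vertex labeled `a`; both halves keep the label of `e`
  {g' | ∃ e ∈ g.E, ∃ a : L,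
    g'.V = insert g.fresh g.V ∧
    g'.E = insert (e.1, g.fresh) (insert (g.fresh, e.2) (g.E.erase e)) ∧
    g'.lv = Function.update g.lv g.fresh a ∧
    g'.le = Function.update (Function.update g.le (e.1, g.fresh) (g.le e))
      (g.fresh, e.2) (g.le e)}

/-- The upward refinement operator `γ_f`, given by rewrite rules UR0 and UR1. -/
def gamma_f (g : DLG L) : Set (DLG L) :=
  {g' |
    -- UR0: remove a non-bridge edge
    (∃ e ∈ g.E, ¬ g.IsBridge e ∧ g' = g.removeEdge e) ∨
    -- UR1: remove a vertex incident to at most one edge, with its incident edges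
    (∃ v ∈ g.V, (g.incident v).card ≤ 1 ∧
      g'.V = g.V.erase v ∧ g'.E = g.E \ g.incident v ∧
      g'.lv = g.lv ∧ g'.le = g.le)}

/-- The upward refinement operator `γ_tf`, given by rules UR0, UR1 together with the
shorten-edge rule UR2. -/
def gamma_tf (g : DLG L) : Set (DLG L) :=
  gamma_f g ∪
  -- UR2: replace edges `(v₁,v₂)`, `(v₂,v₃)` with the same label, where `v₂` has no other
  -- incident edges, by a single edge `(v₁,v₃)` with that label, deleting `v₂`
  {g' | ∃ v₁ v₂ v₃ : ℕ, (v₁, v₂) ∈ g.E ∧ (v₂, v₃) ∈ g.E ∧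
    g.le (v₁, v₂) = g.le (v₂, v₃) ∧
    (∀ e ∈ g.E, e ≠ (v₁, v₂) → e.2 ≠ v₂) ∧
    (∀ e ∈ g.E, e ≠ (v₂, v₃) → e.1 ≠ v₂) ∧
    g'.V = g.V.erase v₂ ∧
    g'.E = insert (v₁, v₃) ((g.E.erase (v₁, v₂)).erase (v₂, v₃)) ∧
    g'.lv = g.lv ∧
    g'.le = Function.update g.le (v₁, v₃) (g.le (v₁, v₂))}

/-! ### Refinement operators for order-labeled DLGs
Here the label set carries a partial order `≤` (standing for `⪯`) and `T` denotes the
distinguished most general label `⊤` (with `T ≤ a` for every label `a`). -/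

section OrderLabeledOps

variable [PartialOrder L]

/-- The downward refinement operator `ρ_⪯`, given by rules R0PO–R5PO. -/
def rhoPO (T : L) (g : DLG L) : Set (DLG L) :=
  {g' |
    -- R0PO: add a single vertex labeled ⊤ to the empty graph
    (g.V = ∅ ∧ g.E = ∅ ∧
      g'.V = {g.fresh} ∧ g'.E = ∅ ∧
      g'.lv = Function.update g.lv g.fresh T ∧ g'.le = g.le) ∨
    -- R1PO: add a new vertex `v*` labeled ⊤ and the edge `(v₁, v*)` labeled ⊤
    (∃ v₁ ∈ g.V,
      g'.V = insert g.fresh g.V ∧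
      g'.E = insert (v₁, g.fresh) g.E ∧
      g'.lv = Function.update g.lv g.fresh T ∧
      g'.le = Function.update g.le (v₁, g.fresh) T) ∨
    -- R2PO: add a new vertex `v*` labeled ⊤ and the edge `(v*, v₁)` labeled ⊤
    (∃ v₁ ∈ g.V,
      g'.V = insert g.fresh g.V ∧
      g'.E = insert (g.fresh, v₁) g.E ∧
      g'.lv = Function.update g.lv g.fresh T ∧
      g'.le = Function.update g.le (g.fresh, v₁) T) ∨
    -- R3PO: add an edge `(v₁, v₂)` labeled ⊤
    (∃ v₁ ∈ g.V, ∃ v₂ ∈ g.V, (v₁, v₂) ∉ g.E ∧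
      g'.V = g.V ∧ g'.E = insert (v₁, v₂) g.E ∧
      g'.lv = g.lv ∧ g'.le = Function.update g.le (v₁, v₂) T) ∨
    -- R4PO: refine a vertex label one step downwards in `⪯`
    (∃ v₁ ∈ g.V, ∃ b : L, g.lv v₁ < b ∧ (¬ ∃ c : L, g.lv v₁ < c ∧ c < b) ∧
      g'.V = g.V ∧ g'.E = g.E ∧
      g'.lv = Function.update g.lv v₁ b ∧ g'.le = g.le) ∨
    -- R5PO: refine an edge label one step downwards in `⪯`
    (∃ e ∈ g.E, ∃ b : L, g.le e < b ∧ (¬ ∃ c : L, g.le e < c ∧ c < b) ∧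
      g'.V = g.V ∧ g'.E = g.E ∧
      g'.lv = g.lv ∧ g'.le = Function.update g.le e b)}

/-- The downward refinement operator `ρ_t⪯`, given by rules R0PO–R5PO together with the
split-edge rule R6PO. -/
def rhoTPO (T : L) (g : DLG L) : Set (DLG L) :=
  rhoPO T g ∪
  -- R6PO: split an edge `e` by a new vertex labeled ⊤; both halves keep the label of `e`
  {g' | ∃ e ∈ g.E,
    g'.V = insert g.fresh g.V ∧
    g'.E = insert (e.1, g.fresh) (insert (g.fresh, e.2) (g.E.erase e)) ∧
    g'.lv = Function.update g.lv g.fresh T ∧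
    g'.le = Function.update (Function.update g.le (e.1, g.fresh) (g.le e))
      (g.fresh, e.2) (g.le e)}

/-- The upward refinement operator `γ_⪯`, given by rules UR0PO–UR3PO. -/
def gammaPO (T : L) (g : DLG L) : Set (DLG L) :=
  {g' |
    -- UR0PO: generalize a vertex label one step upwards in `⪯`
    (∃ v₁ ∈ g.V, ∃ b : L, b < g.lv v₁ ∧ (¬ ∃ c : L, b < c ∧ c < g.lv v₁) ∧
      g'.V = g.V ∧ g'.E = g.E ∧
      g'.lv = Function.update g.lv v₁ b ∧ g'.le = g.le) ∨
    -- UR1PO: generalize an edge label one step upwards in `⪯`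
    (∃ e ∈ g.E, ∃ b : L, b < g.le e ∧ (¬ ∃ c : L, b < c ∧ c < g.le e) ∧
      g'.V = g.V ∧ g'.E = g.E ∧
      g'.lv = g.lv ∧ g'.le = Function.update g.le e b) ∨
    -- UR2PO: remove a non-bridge edge labeled ⊤
    (∃ e ∈ g.E, g.le e = T ∧ ¬ g.IsBridge e ∧ g' = g.removeEdge e) ∨
    -- UR3PO: remove a vertex labeled ⊤ incident to at most one edge, all incident
    -- edges being labeled ⊤, together with those edges
    (∃ v ∈ g.V, g.lv v = T ∧ (g.incident v).card ≤ 1 ∧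
      (∀ e ∈ g.incident v, g.le e = T) ∧
      g'.V = g.V.erase v ∧ g'.E = g.E \ g.incident v ∧
      g'.lv = g.lv ∧ g'.le = g.le)}

/-- The upward refinement operator `γ_t⪯`, given by rules UR0PO–UR3PO together with the
shorten-edge rule UR4PO. -/
def gammaTPO (T : L) (g : DLG L) : Set (DLG L) :=
  gammaPO T g ∪
  -- UR4PO: as UR2, additionally requiring the removed middle vertex to be labeled ⊤
  {g' | ∃ v₁ v₂ v₃ : ℕ, (v₁, v₂) ∈ g.E ∧ (v₂, v₃) ∈ g.E ∧
    g.lv v₂ = T ∧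
    g.le (v₁, v₂) = g.le (v₂, v₃) ∧
    (∀ e ∈ g.E, e ≠ (v₁, v₂) → e.2 ≠ v₂) ∧
    (∀ e ∈ g.E, e ≠ (v₂, v₃) → e.1 ≠ v₂) ∧
    g'.V = g.V.erase v₂ ∧
    g'.E = insert (v₁, v₃) ((g.E.erase (v₁, v₂)).erase (v₂, v₃)) ∧
    g'.lv = g.lv ∧
    g'.le = Function.update g.le (v₁, v₃) (g.le (v₁, v₂))}

end OrderLabeledOps

/-- The cover of `g₁` over `g₂` via a mapping `m`: the subgraph of `g₂` consisting of the
vertices and edges referred to by `m`. -/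
def cover (g₁ g₂ : DLG L) (m : ℕ → ℕ) : DLG L where
  V := g₁.V.image m
  E := g₁.E.image fun e => (m e.1, m e.2)
  lv := g₂.lv
  le := g₂.le
  edge_mem := by
    intro e he
    simp only [Finset.mem_image] at he
    obtain ⟨e', he', rfl⟩ := he
    exact ⟨Finset.mem_image_of_mem m (g₁.edge_mem e' he').1,
      Finset.mem_image_of_mem m (g₁.edge_mem e' he').2⟩

end DLG

namespace DLG

open Relation

variable {L : Type}

theorem fresh_notMem (g : DLG L) : g.fresh ∉ g.V := fun h => by
  have := Finset.le_sup (f := id) h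
  simp only [fresh, id] at this
  omega

theorem notMem_edges_of_fst {g : DLG L} {e : ℕ × ℕ} (h : e.1 ∉ g.V) : e ∉ g.E :=
  fun he => h (g.edge_mem e he).1

theorem notMem_edges_of_snd {g : DLG L} {e : ℕ × ℕ} (h : e.2 ∉ g.V) : e ∉ g.E :=
  fun he => h (g.edge_mem e he).2

theorem edges_eq_empty {g : DLG L} (hV : g.V = ∅) : g.E = ∅ :=
  Finset.eq_empty_of_forall_notMem fun e => notMem_edges_of_fst (by simp [hV])

/-- A connected graph has an edge leaving any nonempty proper set of vertices. -/
theorem Connected.exists_adj {g : DLG L} {S : Finset ℕ} (hg : g.Connected)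
    (hS : S.Nonempty) (hSg : S ⊂ g.V) :
    ∃ v ∈ S, ∃ u ∉ S, g.adj v u := by
  obtain ⟨w, hw⟩ := hS
  obtain ⟨x, hx, hxS⟩ := Finset.exists_of_ssubset hSg
  by_contra! hcon
  have : ∀ y, ReflTransGen g.adj w y → y ∈ S := fun y hy => by
    induction hy with
    | refl => exact hw
    | tail _ hyz ih => exact by_contra fun hz => hcon _ ih _ hz hyz
  exact hxS (this x (hg w (hSg.1 hw) x hx))

theorem ext_of_fields {g g' : DLG L} (hV : g.V = g'.V) (hE : g.E = g'.E) (hlv : g.lv = g'.lv)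
    (hle : g.le = g'.le) : g = g' := by
  cases g; cases g'; simp_all

/-! ### Local finiteness -/

section LocallyFinite

variable [PartialOrder L]

/-- Every refinement stays within the vertices of `g` and its fresh vertex, and changes at most
one vertex label and two edge labels. -/
theorem bounds_of_mem_rhoTPO {T : L} {g g' : DLG L} (h : g' ∈ rhoTPO T g) :
    g'.V ⊆ insert g.fresh g.V ∧
    (∃ v ∈ insert g.fresh g.V, ∃ a, g'.lv = Function.update g.lv v a) ∧
    (∃ e ∈ insert g.fresh g.V ×ˢ insert g.fresh g.V,
      ∃ e' ∈ insert g.fresh g.V ×ˢ insert g.fresh g.V, ∃ a b,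
        g'.le = Function.update (Function.update g.le e a) e' b) := by
  have hlv : ∃ v ∈ insert g.fresh g.V, ∃ a, g.lv = Function.update g.lv v a :=
    ⟨g.fresh, by simp, g.lv g.fresh, by simp⟩
  have hle : ∀ d ∈ insert g.fresh g.V ×ˢ insert g.fresh g.V, ∀ c f,
      f = Function.update g.le d c →
      ∃ e ∈ insert g.fresh g.V ×ˢ insert g.fresh g.V,
      ∃ e' ∈ insert g.fresh g.V ×ˢ insert g.fresh g.V, ∃ a b,
        f = Function.update (Function.update g.le e a) e' b :=
    fun d hd c f hf => ⟨d, hd, d, hd, c, c, by simp [hf]⟩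
  have hle₀ := hle (g.fresh, g.fresh) (by simp) _ g.le (Function.update_eq_self _ _).symm
  rcases h with (⟨-, -, hV, -, hl, he⟩ | ⟨v, hv, hV, -, hl, he⟩ | ⟨v, hv, hV, -, hl, he⟩ |
    ⟨v, hv, w, hw, -, hV, -, hl, he⟩ | ⟨v, hv, b, -, -, hV, -, hl, he⟩ |
    ⟨e, hmem, b, -, -, hV, -, hl, he⟩) | ⟨e, hmem, hV, -, hl, he⟩ <;> rw [hV, hl, he]
  · exact ⟨by simp, ⟨g.fresh, by simp, T, rfl⟩, hle₀⟩
  · exact ⟨by simp, ⟨g.fresh, by simp, T, rfl⟩, hle _ (by simp [hv]) _ _ rfl⟩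
  · exact ⟨by simp, ⟨g.fresh, by simp, T, rfl⟩, hle _ (by simp [hv]) _ _ rfl⟩
  · exact ⟨by simp, hlv, hle _ (by simp [hv, hw]) _ _ rfl⟩
  · exact ⟨by simp, ⟨v, by simp [hv], b, rfl⟩, hle₀⟩
  · exact ⟨by simp, hlv, hle _ (by simp [g.edge_mem e hmem]) _ _ rfl⟩
  · exact ⟨by simp, ⟨g.fresh, by simp, T, rfl⟩, (e.1, g.fresh), by simp [g.edge_mem e hmem],
      (g.fresh, e.2), by simp [g.edge_mem e hmem], _, _, rfl⟩

theorem finite_rhoTPO [Fintype L] (T : L) (g : DLG L) : (rhoTPO T g).Finite := by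
  let N := insert g.fresh g.V
  let A : Set (ℕ → L) :=
    Set.range fun p : N × L => Function.update g.lv p.1 p.2
  let B : Set (ℕ × ℕ → L) :=
    Set.range fun p : (↥(N ×ˢ N) × ↥(N ×ˢ N)) × (L × L) =>
      Function.update (Function.update g.le p.1.1 p.2.1) p.1.2 p.2.2
  let φ : DLG L → Finset ℕ × Finset (ℕ × ℕ) × (ℕ → L) × (ℕ × ℕ → L) :=
    fun h => (h.V, h.E, h.lv, h.le)
  have hφ : Function.Injective φ := fun h h' hh => by
    simp only [φ, Prod.mk.injEq] at hh
    exact ext_of_fields hh.1 hh.2.1 hh.2.2.1 hh.2.2.2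
  have hfin : ((N.powerset : Set (Finset ℕ)) ×ˢ
      (((N ×ˢ N).powerset : Set (Finset (ℕ × ℕ))) ×ˢ (A ×ˢ B))).Finite :=
    (Finset.finite_toSet _).prod ((Finset.finite_toSet _).prod
      ((Set.finite_range _).prod (Set.finite_range _)))
  refine (hfin.preimage hφ.injOn).subset fun h hh => ?_
  obtain ⟨hV, ⟨v, hv, a, hlv⟩, e, he, e', he', b, c, hle⟩ := bounds_of_mem_rhoTPO hh
  refine ⟨Finset.mem_coe.2 (Finset.mem_powerset.2 hV),
    Finset.mem_coe.2 (Finset.mem_powerset.2 fun d hd => ?_), ?_, ?_⟩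
  · exact Finset.mem_product.2 ⟨hV (h.edge_mem d hd).1, hV (h.edge_mem d hd).2⟩
  · exact ⟨(⟨v, hv⟩, a), hlv.symm⟩
  · exact ⟨((⟨e, he⟩, ⟨e', he'⟩), (b, c)), hle.symm⟩

end LocallyFinite

/-! ### Trans-subsumption through transitive closures -/

section Hom

variable [PartialOrder L]

/-- The edges of `g` whose label refines `a`. -/
def edgeAbove (g : DLG L) (a : L) (v w : ℕ) : Prop := (v, w) ∈ g.E ∧ a ≤ g.le (v, w)

/-- `m` is a vertex map witnessing that `h` trans-subsumes `g`. -/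
structure IsTransHom (h g : DLG L) (m : ℕ → ℕ) : Prop where
  map_mem : ∀ v ∈ h.V, m v ∈ g.V
  label_le : ∀ v ∈ h.V, h.lv v ≤ g.lv (m v)
  path : ∀ e ∈ h.E, TransGen (g.edgeAbove (h.le e)) (m e.1) (m e.2)

theorem transGen_iff_exists_list {r : ℕ → ℕ → Prop} {a b : ℕ} :
    TransGen r a b ↔
      ∃ l : List ℕ, 2 ≤ l.length ∧ l.head? = some a ∧ l.getLast? = some b ∧ l.IsChain r := by
  constructor
  · intro h
    induction h using TransGen.head_induction_on with
    | @single a h => exact ⟨[a, b], by simp, by simp, by simp, by simpa using h⟩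
    | @head a c h _ ih =>
      obtain ⟨l, h₁, h₂, h₃, h₄⟩ := ih
      match l, h₁, h₂, h₃, h₄ with
      | x :: y :: l, _, h₂, h₃, h₄ =>
        obtain rfl : x = c := by simpa using h₂
        exact ⟨a :: x :: y :: l, by simp, rfl, by simpa using h₃, by
          rw [List.isChain_cons_cons]; exact ⟨h, h₄⟩⟩
  · rintro ⟨l, h₁, h₂, h₃, h₄⟩
    induction l generalizing a with
    | nil => simp at h₁
    | cons x l ih =>
      obtain rfl : x = a := by simpa using h₂
      match l, h₁, h₃, h₄ with
      | [y], _, h₃, h₄ =>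
        obtain rfl : y = b := by simpa using h₃
        exact .single (by simpa using h₄)
      | y :: z :: l, _, h₃, h₄ =>
        rw [List.isChain_cons_cons] at h₄
        exact .head h₄.1 (ih (by simp) rfl (by simpa using h₃) h₄.2)

theorem transSubsPO_iff {h g : DLG L} : TransSubsPO h g ↔ ∃ m, IsTransHom h g m := by
  constructor
  · rintro ⟨m, me, hV, hl, hE⟩
    exact ⟨m, hV, hl, fun e he => transGen_iff_exists_list.2 ⟨me e, hE e he⟩⟩
  · rintro ⟨m, hm⟩
    choose! me hme using fun e he => transGen_iff_exists_list.1 (hm.path e he)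
    exact ⟨m, me, hm.map_mem, hm.label_le, hme⟩

theorem transSubsPO_of_empty {g : DLG L} (hV : g.V = ∅) (h : DLG L) : TransSubsPO g h :=
  transSubsPO_iff.2 ⟨id, by simp [hV], by simp [hV], by simp [edges_eq_empty hV]⟩

end Hom

/-! ### Composite refinement steps -/

/-- Relabel the vertex `v` with `a`. -/
def setVertexLabel (g : DLG L) (v : ℕ) (a : L) : DLG L :=
  { g with lv := Function.update g.lv v a }

/-- Relabel the edge `e` with `b`. -/
def setEdgeLabel (g : DLG L) (e : ℕ × ℕ) (b : L) : DLG L :=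
  { g with le := Function.update g.le e b }

/-- Add the edge `e`, labeled `b`. -/
def addEdge (g : DLG L) (e : ℕ × ℕ) (he : e.1 ∈ g.V ∧ e.2 ∈ g.V) (b : L) : DLG L where
  V := g.V
  E := insert e g.E
  lv := g.lv
  le := Function.update g.le e b
  edge_mem := Finset.forall_mem_insert _ _ _ |>.2 ⟨he, g.edge_mem⟩

/-- The edge `e` joins the fresh vertex of `g` to a vertex of `g`. -/
def IsPendant (g : DLG L) (e : ℕ × ℕ) : Prop :=
  (e.1 ∈ g.V ∧ e.2 = g.fresh) ∨ (e.1 = g.fresh ∧ e.2 ∈ g.V)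

/-- Add the fresh vertex, labeled `a`, along with the edge `e` joining it to `g`, labeled `b`. -/
def addPendant (g : DLG L) (e : ℕ × ℕ) (he : g.IsPendant e) (a b : L) : DLG L where
  V := insert g.fresh g.V
  E := insert e g.E
  lv := Function.update g.lv g.fresh a
  le := Function.update g.le e b
  edge_mem := Finset.forall_mem_insert _ _ _ |>.2
    ⟨by rcases he with h | h <;> simp [h], fun d hd => by simp [g.edge_mem d hd]⟩

theorem IsPendant.notMem_edges {g : DLG L} {e : ℕ × ℕ} (he : g.IsPendant e) : e ∉ g.E := by
  rcases he with ⟨-, h⟩ | ⟨h, -⟩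
  · exact notMem_edges_of_snd (h ▸ g.fresh_notMem)
  · exact notMem_edges_of_fst (h ▸ g.fresh_notMem)

section Refines

variable [PartialOrder L]

/-- `g'` is reachable from `g` by finitely many refinement steps. -/
abbrev Refines (T : L) : DLG L → DLG L → Prop := ReflTransGen fun x y => y ∈ rhoTPO T x

theorem reflTransGen_covBy_of_le [Fintype L] {a b : L} (h : a ≤ b) :
    ReflTransGen (· ⋖ ·) a b := by
  classical
  let := Fintype.toLocallyFiniteOrder (α := L)
  exact le_iff_reflTransGen_covBy.1 h

variable [Fintype L] {T : L} {g : DLG L}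

theorem refines_setVertexLabel {v : ℕ} {a : L} (hv : v ∈ g.V) (ha : g.lv v ≤ a) :
    Refines T g (g.setVertexLabel v a) := by
  have hcov := reflTransGen_covBy_of_le ha
  clear ha
  induction hcov with
  | refl => rw [show g.setVertexLabel v (g.lv v) = g by simp [setVertexLabel]]
  | @tail b c _ hc ih =>
    refine ih.tail ?_
    refine Or.inl (Or.inr (Or.inr (Or.inr (Or.inr (Or.inl ⟨v, hv, c, ?_, ?_, rfl, rfl, ?_, rfl⟩)))))
    · simpa [setVertexLabel] using hc.1
    · rintro ⟨d, h₁, h₂⟩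
      exact hc.2 (by simpa [setVertexLabel] using h₁) h₂
    · simp [setVertexLabel]

theorem refines_setEdgeLabel {e : ℕ × ℕ} {b : L} (he : e ∈ g.E) (hb : g.le e ≤ b) :
    Refines T g (g.setEdgeLabel e b) := by
  have hcov := reflTransGen_covBy_of_le hb
  clear hb
  induction hcov with
  | refl => rw [show g.setEdgeLabel e (g.le e) = g by simp [setEdgeLabel]]
  | @tail c d _ hd ih =>
    refine ih.tail ?_
    refine Or.inl (Or.inr (Or.inr (Or.inr (Or.inr (Or.inr ⟨e, he, d, ?_, ?_, rfl, rfl, rfl, ?_⟩)))))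
    · simpa [setEdgeLabel] using hd.1
    · rintro ⟨x, h₁, h₂⟩
      exact hd.2 (by simpa [setEdgeLabel] using h₁) h₂
    · simp [setEdgeLabel]

theorem refines_addEdge (hT : ∀ a : L, T ≤ a) {e : ℕ × ℕ} (he : e.1 ∈ g.V ∧ e.2 ∈ g.V)
    (hne : e ∉ g.E) (b : L) : Refines T g (g.addEdge e he b) := by
  have h₁ : Refines T g (g.addEdge e he T) := .single <|
    Or.inl (Or.inr (Or.inr (Or.inr (Or.inl
      ⟨e.1, he.1, e.2, he.2, hne, rfl, rfl, rfl, rfl⟩))))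
  have h₂ := refines_setEdgeLabel (T := T) (g := g.addEdge e he T) (e := e) (b := b)
    (Finset.mem_insert_self _ _) (by simpa [addEdge] using hT b)
  exact h₁.trans (by simpa [setEdgeLabel, addEdge] using h₂)

theorem refines_addPendant (hT : ∀ a : L, T ≤ a) {e : ℕ × ℕ} (he : g.IsPendant e) (a b : L) :
    Refines T g (g.addPendant e he a b) := by
  have h₁ : Refines T g (g.addPendant e he T T) := by
    obtain ⟨v, w⟩ := e
    refine .single (Or.inl ?_)
    rcases id he with ⟨hv, hw⟩ | ⟨hv, hw⟩
    · obtain rfl : w = g.fresh := hw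
      exact Or.inr (Or.inl ⟨v, hv, rfl, rfl, rfl, rfl⟩)
    · obtain rfl : v = g.fresh := hv
      exact Or.inr (Or.inr (Or.inl ⟨w, hw, rfl, rfl, rfl, rfl⟩))
  have h₂ := refines_setEdgeLabel (T := T) (g := g.addPendant e he T T) (e := e) (b := b)
    (Finset.mem_insert_self _ _) (by simpa [addPendant] using hT b)
  have h₃ := refines_setVertexLabel (T := T) (g := (g.addPendant e he T T).setEdgeLabel e b)
    (v := g.fresh) (a := a) (Finset.mem_insert_self _ _)
    (by simpa [addPendant, setEdgeLabel] using hT a)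
  exact h₁.trans (h₂.trans (by simpa [setVertexLabel, setEdgeLabel, addPendant] using h₃))

end Refines

/-! ### Growing a copy of the target -/

section Completeness

variable [PartialOrder L] {h g : DLG L} {m : ℕ → ℕ}

theorem IsTransHom.addPendant (hm : IsTransHom h g m) {e : ℕ × ℕ} (he : h.IsPendant e) {w : ℕ}
    (hw : w ∈ g.V) {a b : L} (ha : a ≤ g.lv w)
    (hb : g.edgeAbove b (Function.update m h.fresh w e.1) (Function.update m h.fresh w e.2)) :
    IsTransHom (h.addPendant e he a b) g (Function.update m h.fresh w) := by
  have hne : ∀ v ∈ h.V, v ≠ h.fresh := fun v hv => ne_of_mem_of_not_mem hv h.fresh_notMem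
  refine ⟨?_, ?_, ?_⟩
  · refine (Finset.forall_mem_insert _ _ _).2 ⟨by simpa using hw, fun v hv => ?_⟩
    simpa [hne v hv] using hm.map_mem v hv
  · refine (Finset.forall_mem_insert _ _ _).2 ⟨by simpa [DLG.addPendant] using ha, fun v hv => ?_⟩
    simpa [hne v hv, DLG.addPendant] using hm.label_le v hv
  · refine (Finset.forall_mem_insert _ _ _).2
      ⟨.single (by simpa [DLG.addPendant] using hb), fun d hd => ?_⟩
    have hde : d ≠ e := ne_of_mem_of_not_mem hd he.notMem_edges
    simpa [hde, hne _ (h.edge_mem d hd).1, hne _ (h.edge_mem d hd).2, DLG.addPendant]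
      using hm.path d hd

/-- `h` trans-subsumes `g` through `m`, and `s` is a section of `m` over the vertices `S` of `g`
embedding the subgraph of `g` with vertices `S` and edges `F` as a full subgraph of `h`. -/
structure PartialCopy (h g : DLG L) (S : Finset ℕ) (F : Finset (ℕ × ℕ)) (m s : ℕ → ℕ) : Prop where
  hom : IsTransHom h g m
  subset : S ⊆ g.V
  map_mem : ∀ w ∈ S, s w ∈ h.V
  section_eq : ∀ w ∈ S, m (s w) = w
  label : ∀ w ∈ S, h.lv (s w) = g.lv w
  edge_mem : ∀ e ∈ F, (s e.1, s e.2) ∈ h.E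
  edge_label : ∀ e ∈ F, h.le (s e.1, s e.2) = g.le e
  ends : ∀ e ∈ F, e.1 ∈ S ∧ e.2 ∈ S
  full : ∀ v ∈ S, ∀ w ∈ S, (s v, s w) ∈ h.E → (v, w) ∈ F

variable {S : Finset ℕ} {F : Finset (ℕ × ℕ)} {s : ℕ → ℕ}

theorem PartialCopy.injOn (c : PartialCopy h g S F m s) : Set.InjOn s S :=
  fun v hv w hw hvw => by rw [← c.section_eq v hv, hvw, c.section_eq w hw]

theorem PartialCopy.addEdge (c : PartialCopy h g S F m s) {e : ℕ × ℕ} (he : e ∈ g.E)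
    (h₁ : e.1 ∈ S) (h₂ : e.2 ∈ S) (hF : e ∉ F) :
    PartialCopy (h.addEdge (s e.1, s e.2) ⟨c.map_mem _ h₁, c.map_mem _ h₂⟩ (g.le e)) g S
      (insert e F) m s := by
  have hne : (s e.1, s e.2) ∉ h.E := fun hmem => hF (c.full _ h₁ _ h₂ hmem)
  refine ⟨⟨c.hom.map_mem, c.hom.label_le, ?_⟩, c.subset, c.map_mem, c.section_eq, c.label,
    ?_, ?_, ?_, ?_⟩
  · refine (Finset.forall_mem_insert _ _ _).2 ⟨.single ?_, fun d hd => ?_⟩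
    · simpa [c.section_eq _ h₁, c.section_eq _ h₂, edgeAbove, DLG.addEdge] using he
    · simpa [ne_of_mem_of_not_mem hd hne, DLG.addEdge] using c.hom.path d hd
  · refine (Finset.forall_mem_insert _ _ _).2 ⟨Finset.mem_insert_self _ _, fun d hd => ?_⟩
    exact Finset.mem_insert_of_mem (c.edge_mem d hd)
  · refine (Finset.forall_mem_insert _ _ _).2 ⟨by simp [DLG.addEdge], fun d hd => ?_⟩
    have := ne_of_mem_of_not_mem (c.edge_mem d hd) hne
    simpa only [DLG.addEdge, Function.update_of_ne this] using c.edge_label d hd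
  · exact (Finset.forall_mem_insert _ _ _).2 ⟨⟨h₁, h₂⟩, c.ends⟩
  · intro v hv w hw hvw
    rcases Finset.mem_insert.1 hvw with hvw | hvw
    · rw [Prod.mk.injEq] at hvw
      rw [c.injOn hv h₁ hvw.1, c.injOn hw h₂ hvw.2]
      exact Finset.mem_insert_self _ _
    · exact Finset.mem_insert_of_mem (c.full v hv w hw hvw)

theorem PartialCopy.isPendant (c : PartialCopy h g S F m s) {u : ℕ} (hu : u ∉ S) {e : ℕ × ℕ}
    (hS : (e.1 ∈ S ∧ e.2 = u) ∨ (e.1 = u ∧ e.2 ∈ S)) :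
    h.IsPendant (Function.update s u h.fresh e.1, Function.update s u h.fresh e.2) := by
  rcases hS with ⟨h₁, h₂⟩ | ⟨h₁, h₂⟩
  · exact Or.inl ⟨by simpa [ne_of_mem_of_not_mem h₁ hu] using c.map_mem _ h₁, by simp [h₂]⟩
  · exact Or.inr ⟨by simp [h₁], by simpa [ne_of_mem_of_not_mem h₂ hu] using c.map_mem _ h₂⟩

theorem PartialCopy.addPendant (c : PartialCopy h g S F m s) {u : ℕ} (hu : u ∉ S) {e : ℕ × ℕ}
    (he : e ∈ g.E) (hS : (e.1 ∈ S ∧ e.2 = u) ∨ (e.1 = u ∧ e.2 ∈ S)) :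
    PartialCopy (h.addPendant _ (c.isPendant hu hS) (g.lv u) (g.le e)) g (insert u S)
      (insert e F) (Function.update m h.fresh u) (Function.update s u h.fresh) := by
  have hug : u ∈ g.V := by
    rcases hS with ⟨-, h₂⟩ | ⟨h₁, -⟩
    · exact h₂ ▸ (g.edge_mem e he).2
    · exact h₁ ▸ (g.edge_mem e he).1
  have hends : e.1 ∈ insert u S ∧ e.2 ∈ insert u S := by
    rcases hS with h | h <;> simp [h]
  have hne : ∀ w ∈ S, w ≠ u := fun w hw => ne_of_mem_of_not_mem hw hu
  have hfr : ∀ w ∈ S, s w ≠ h.fresh :=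
    fun w hw => ne_of_mem_of_not_mem (c.map_mem w hw) h.fresh_notMem
  have hsec : ∀ w ∈ insert u S,
      Function.update m h.fresh u (Function.update s u h.fresh w) = w := by
    refine (Finset.forall_mem_insert _ _ _).2 ⟨by simp, fun w hw => ?_⟩
    simpa [hne w hw, hfr w hw] using c.section_eq w hw
  refine ⟨c.hom.addPendant _ hug le_rfl ?_, Finset.insert_subset hug c.subset, ?_, hsec, ?_, ?_,
    ?_, ?_, ?_⟩
  · simpa only [hsec _ hends.1, hsec _ hends.2] using ⟨he, le_rfl⟩
  · refine (Finset.forall_mem_insert _ _ _).2 ⟨by simp [DLG.addPendant], fun w hw => ?_⟩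
    simpa [hne w hw, DLG.addPendant] using Or.inr (c.map_mem w hw)
  · refine (Finset.forall_mem_insert _ _ _).2 ⟨by simp [DLG.addPendant], fun w hw => ?_⟩
    simpa [hne w hw, hfr w hw, DLG.addPendant] using c.label w hw
  · refine (Finset.forall_mem_insert _ _ _).2 ⟨Finset.mem_insert_self _ _, fun d hd => ?_⟩
    rw [Function.update_of_ne (hne _ (c.ends d hd).1), Function.update_of_ne (hne _ (c.ends d hd).2)]
    exact Finset.mem_insert_of_mem (c.edge_mem d hd)
  · refine (Finset.forall_mem_insert _ _ _).2 ⟨by simp [DLG.addPendant], fun d hd => ?_⟩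
    rw [Function.update_of_ne (hne _ (c.ends d hd).1), Function.update_of_ne (hne _ (c.ends d hd).2)]
    have := ne_of_mem_of_not_mem (c.edge_mem d hd) (c.isPendant hu hS).notMem_edges
    simpa only [DLG.addPendant, Function.update_of_ne this] using c.edge_label d hd
  · refine (Finset.forall_mem_insert _ _ _).2 ⟨hends, fun d hd => ?_⟩
    exact ⟨Finset.mem_insert_of_mem (c.ends d hd).1, Finset.mem_insert_of_mem (c.ends d hd).2⟩
  · intro v hv w hw hvw
    rcases Finset.mem_insert.1 hvw with hvw | hvw
    · rw [Prod.mk.injEq] at hvw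
      have h₁ := hsec v hv
      have h₂ := hsec w hw
      rw [hvw.1, hsec _ hends.1] at h₁
      rw [hvw.2, hsec _ hends.2] at h₂
      rw [← h₁, ← h₂]
      exact Finset.mem_insert_self _ _
    · have key : ∀ x ∈ insert u S, Function.update s u h.fresh x ∈ h.V → x ∈ S := by
        intro x hx hxV
        rcases Finset.mem_insert.1 hx with rfl | hx
        · simp [h.fresh_notMem] at hxV
        · exact hx
      have hv' := key v hv (h.edge_mem _ hvw).1
      have hw' := key w hw (h.edge_mem _ hvw).2
      rw [Function.update_of_ne (hne v hv'), Function.update_of_ne (hne w hw')] at hvw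
      exact Finset.mem_insert_of_mem (c.full v hv' w hw' hvw)

/-- A complete copy of `g` in `h` makes the two graphs equivalent. -/
theorem PartialCopy.isTransHom_section (c : PartialCopy h g g.V F m s) (hF : g.E ⊆ F) :
    IsTransHom g h s where
  map_mem := c.map_mem
  label_le v hv := (c.label v hv).ge
  path e he := .single ⟨c.edge_mem e (hF he), (c.edge_label e (hF he)).ge⟩

variable [Fintype L] {T : L}

theorem PartialCopy.exists_all_vertices (hT : ∀ a : L, T ≤ a) (hg : g.Connected)
    (c : PartialCopy h g S F m s) (hS : S.Nonempty) :
    ∃ h' F' m' s', Refines T h h' ∧ PartialCopy h' g g.V F' m' s' := by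
  induction hn : (g.V \ S).card using Nat.strong_induction_on generalizing h S F m s with
  | _ n ih =>
    rcases c.subset.eq_or_ssubset with rfl | hss
    · exact ⟨h, F, m, s, .refl, c⟩
    obtain ⟨v, hv, u, hu, hadj⟩ := hg.exists_adj hS hss
    obtain ⟨e, he, hcase⟩ : ∃ e ∈ g.E, (e.1 ∈ S ∧ e.2 = u) ∨ (e.1 = u ∧ e.2 ∈ S) := by
      rcases hadj with h | h
      · exact ⟨_, h, Or.inl ⟨hv, rfl⟩⟩
      · exact ⟨_, h, Or.inr ⟨rfl, hv⟩⟩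
    have c' := c.addPendant hu he hcase
    have hlt : (g.V \ insert u S).card < n := by
      refine hn ▸ Finset.card_lt_card ((Finset.ssubset_iff_of_subset ?_).2 ⟨u, ?_, ?_⟩)
      · exact Finset.sdiff_subset_sdiff subset_rfl (Finset.subset_insert _ _)
      · rcases hcase with h | h
        · simpa [hu, h.2] using (g.edge_mem e he).2
        · simpa [hu, h.1] using (g.edge_mem e he).1
      · simp
    obtain ⟨h', F', m', s', hr, hc⟩ := ih _ hlt c' (Finset.insert_nonempty _ _) rfl
    exact ⟨h', F', m', s', (refines_addPendant hT _ _ _).trans hr, hc⟩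

theorem PartialCopy.exists_all_edges (hT : ∀ a : L, T ≤ a) (c : PartialCopy h g g.V F m s) :
    ∃ h' F', Refines T h h' ∧ PartialCopy h' g g.V F' m s ∧ g.E ⊆ F' := by
  induction hn : (g.E \ F).card using Nat.strong_induction_on generalizing h F with
  | _ n ih =>
    by_cases hF : g.E ⊆ F
    · exact ⟨h, F, .refl, c, hF⟩
    obtain ⟨e, he, heF⟩ := Finset.not_subset.1 hF
    have h₁ := (g.edge_mem e he).1
    have h₂ := (g.edge_mem e he).2
    have hlt : (g.E \ insert e F).card < n := by
      refine hn ▸ Finset.card_lt_card ((Finset.ssubset_iff_of_subset ?_).2 ⟨e, ?_, ?_⟩)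
      · exact Finset.sdiff_subset_sdiff subset_rfl (Finset.subset_insert _ _)
      · simp [he, heF]
      · simp
    obtain ⟨h', F', hr, hc⟩ := ih _ hlt (c.addEdge he h₁ h₂ heF) rfl
    exact ⟨h', F', (refines_addEdge hT _ (fun hmem => heF (c.full _ h₁ _ h₂ hmem)) _).trans hr, hc⟩

/-- A copy of the connected graph `g` can be grown at any vertex of `h` that carries no loop. -/
theorem IsTransHom.exists_equiv_of_no_loop (hT : ∀ a : L, T ≤ a) (hg : g.Connected)
    (hm : IsTransHom h g m) {v : ℕ} (hv : v ∈ h.V) (hloop : (v, v) ∉ h.E) :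
    ∃ h', Refines T h h' ∧ TransSubsPO h' g ∧ TransSubsPO g h' := by
  have c : PartialCopy (h.setVertexLabel v (g.lv (m v))) g {m v} ∅ m (fun _ => v) := by
    refine ⟨⟨hm.map_mem, fun w hw => ?_, hm.path⟩, by simpa using hm.map_mem v hv,
      fun _ _ => hv, by simp, by simp [setVertexLabel], by simp, by simp, by simp,
      fun _ _ _ _ hmem => (hloop hmem).elim⟩
    by_cases hwv : w = v
    · simp [hwv, setVertexLabel]
    · simpa [hwv, setVertexLabel] using hm.label_le w hw
  obtain ⟨h₁, F₁, m₁, s₁, hr₁, c₁⟩ := c.exists_all_vertices hT hg (Finset.singleton_nonempty _)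
  obtain ⟨h₂, F₂, hr₂, c₂, hF⟩ := c₁.exists_all_edges hT
  exact ⟨h₂, ((refines_setVertexLabel hv (hm.label_le v hv)).trans hr₁).trans hr₂,
    transSubsPO_iff.2 ⟨_, c₂.hom⟩, transSubsPO_iff.2 ⟨_, c₂.isTransHom_section hF⟩⟩

theorem IsTransHom.exists_equiv (hT : ∀ a : L, T ≤ a) (hg : g.Connected)
    (hm : IsTransHom h g m) {v : ℕ} (hv : v ∈ h.V) :
    ∃ h', Refines T h h' ∧ TransSubsPO h' g ∧ TransSubsPO g h' := by
  by_cases hloop : (v, v) ∈ h.E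
  · obtain ⟨w, hw, -⟩ := TransGen.head'_iff.1 (hm.path _ hloop)
    have hvf : v ≠ h.fresh := ne_of_mem_of_not_mem hv h.fresh_notMem
    have he : h.IsPendant (v, h.fresh) := Or.inl ⟨hv, rfl⟩
    have hm' : IsTransHom (h.addPendant _ he T T) g (Function.update m h.fresh w) :=
      hm.addPendant he (g.edge_mem _ hw.1).2 (hT _) (by simpa [hvf] using ⟨hw.1, hT _⟩)
    obtain ⟨h', hr, hsubs⟩ := hm'.exists_equiv_of_no_loop hT hg (v := h.fresh)
      (Finset.mem_insert_self _ _) (by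
        simp [DLG.addPendant, hvf.symm, notMem_edges_of_fst (e := (h.fresh, h.fresh))
          h.fresh_notMem])
    exact ⟨h', (refines_addPendant hT _ _ _).trans hr, hsubs⟩
  · exact hm.exists_equiv_of_no_loop hT hg hv hloop

theorem exists_equiv_of_empty (hT : ∀ a : L, T ≤ a) (hg : g.Connected) (hV : h.V = ∅) {w : ℕ}
    (hw : w ∈ g.V) : ∃ h', Refines T h h' ∧ TransSubsPO h' g ∧ TransSubsPO g h' := by
  let h₁ : DLG L := ⟨{h.fresh}, ∅, Function.update h.lv h.fresh T, h.le, by simp⟩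
  have hr : Refines T h h₁ :=
    .single (Or.inl (Or.inl ⟨hV, edges_eq_empty hV, rfl, rfl, rfl, rfl⟩))
  have hm : IsTransHom h₁ g fun _ => w :=
    ⟨fun _ _ => hw, by simp [h₁, hT], by simp [h₁]⟩
  obtain ⟨h', hr', hsubs⟩ := hm.exists_equiv hT hg (v := h.fresh) (by simp [h₁])
  exact ⟨h', hr.trans hr', hsubs⟩

end Completeness

end DLG

theorem rhoTPO_locally_finite_and_complete {L : Type} [Fintype L] [PartialOrder L] (T : L) (hT : ∀ a : L, T ≤ a) :
    -- locally finite
    (∀ g : DLG L, g.Connected → (DLG.rhoTPO T g).Finite) ∧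
    -- complete: if g₁ strictly subsumes g₂, a finite chain of refinements starting
    -- at g₁ reaches a graph equivalent to g₂
    (∀ g₁ g₂ : DLG L, g₁.Connected → g₂.Connected →
      DLG.TransSubsPO g₁ g₂ → ¬ DLG.TransSubsPO g₂ g₁ →
      ∃ h : DLG L, Relation.ReflTransGen (fun x y => y ∈ DLG.rhoTPO T x) g₁ h ∧
        DLG.TransSubsPO h g₂ ∧ DLG.TransSubsPO g₂ h) := by
  refine ⟨fun g _ => DLG.finite_rhoTPO T g, fun g₁ g₂ _ hg₂ h₁₂ h₂₁ => ?_⟩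
  obtain ⟨w, hw⟩ : g₂.V.Nonempty := Finset.nonempty_iff_ne_empty.2
    fun hV => h₂₁ (DLG.transSubsPO_of_empty hV g₁)
  rcases g₁.V.eq_empty_or_nonempty with hV | ⟨v, hv⟩
  · exact DLG.exists_equiv_of_empty hT hg₂ hV hw
  · obtain ⟨m, hm⟩ := DLG.transSubsPO_iff.1 h₁₂
    exact hm.exists_equiv hT hg₂ hv
end

section
/- Under the object identity constraint, the upward refinement operator γ_⪯ defined by the rewrite rules UR0PO, UR1PO, UR2PO, and UR3PO is ideal (locally finite, complete, and proper) for the quasi-ordered set (G, ⊑⪯), where ⊑⪯ is subsumption relative to the partial order ⪯ under object identity. -/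
namespace DLG

variable {L : Type}

/-- `A` induces a connected subgraph of `g`: its vertices are joined by paths inside `A`. -/
def ConnectedOn (g : DLG L) (A : Finset ℕ) : Prop :=
  ∀ x ∈ A, ∀ y ∈ A, Relation.ReflTransGen (fun a b => g.adj a b ∧ a ∈ A ∧ b ∈ A) x y

theorem adj_symm {g : DLG L} {v w : ℕ} (h : g.adj v w) : g.adj w v := h.symm

theorem connected_of_V_eq_of_E_eq {g g' : DLG L} (hV : g'.V = g.V) (hE : g'.E = g.E)
    (hg : g.Connected) : g'.Connected := by
  have hadj : g'.adj = g.adj := by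
    funext v w
    simp [adj, hE]
  unfold Connected
  rw [hadj, hV]
  exact hg

/-- A connected induced subgraph grows by a vertex adjacent to it. -/
theorem ConnectedOn.insert {g : DLG L} {A : Finset ℕ} (hA : g.ConnectedOn A) {a w : ℕ}
    (ha : a ∈ A) (haw : g.adj a w) : g.ConnectedOn (insert w A) := by
  have lift : ∀ x ∈ A, ∀ y ∈ A, Relation.ReflTransGen
      (fun p q => g.adj p q ∧ p ∈ Insert.insert w A ∧ q ∈ Insert.insert w A) x y := by
    intro x hx y hy
    exact Relation.ReflTransGen.mono (fun p q h =>
      ⟨h.1, Finset.mem_insert_of_mem h.2.1, Finset.mem_insert_of_mem h.2.2⟩) _ _ (hA x hx y hy)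
  have hw : w ∈ Insert.insert w A := Finset.mem_insert_self w A
  have ha' : a ∈ Insert.insert w A := Finset.mem_insert_of_mem ha
  intro x hx y hy
  rcases Finset.mem_insert.1 hx with rfl | hxA <;> rcases Finset.mem_insert.1 hy with rfl | hyA
  · exact .refl
  · exact .head ⟨adj_symm haw, hw, ha'⟩ (lift a ha y hyA)
  · exact (lift x hxA a ha).tail ⟨haw, ha', hw⟩
  · exact lift x hxA y hyA

/-- In a connected graph, a proper vertex subset inducing a connected subgraph can be enlarged
by one vertex. -/
theorem Connected.exists_connectedOn_insert {g : DLG L} (hg : g.Connected) {A : Finset ℕ}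
    (hAV : A ⊂ g.V) (hA : g.ConnectedOn A) :
    ∃ w ∈ g.V, w ∉ A ∧ g.ConnectedOn (insert w A) := by
  obtain ⟨y, hyV, hyA⟩ := Finset.exists_of_ssubset hAV
  rcases A.eq_empty_or_nonempty with rfl | ⟨x, hx⟩
  · refine ⟨y, hyV, hyA, fun p hp q hq => ?_⟩
    simp only [insert_empty_eq, Finset.mem_singleton] at hp hq
    subst hp hq
    exact .refl
  · by_contra! hcon
    have hstay : ∀ z, Relation.ReflTransGen g.adj x z → z ∈ A := by
      intro z hz
      induction hz with
      | refl => exact hx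
      | @tail b c _ hbc ih =>
        by_contra hc
        refine hcon c ?_ hc (hA.insert ih hbc)
        rcases hbc with h | h
        · exact (g.edge_mem _ h).2
        · exact (g.edge_mem _ h).1
    exact hyA (hstay y (hg x (hAV.1 hx) y hyV))

/-- Outside a proper vertex subset inducing a connected subgraph there is a vertex which is not
a cut vertex. -/
theorem Connected.exists_connectedOn_erase {g : DLG L} (hg : g.Connected) {A : Finset ℕ}
    (hAV : A ⊂ g.V) (hA : g.ConnectedOn A) :
    ∃ w ∈ g.V, w ∉ A ∧ g.ConnectedOn (g.V.erase w) := by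
  induction hn : (g.V \ A).card using Nat.strong_induction_on generalizing A with
  | _ n ih =>
    obtain ⟨w, hwV, hwA, hwc⟩ := hg.exists_connectedOn_insert hAV hA
    have hsub : insert w A ⊆ g.V := Finset.insert_subset hwV hAV.1
    by_cases heq : insert w A = g.V
    · refine ⟨w, hwV, hwA, ?_⟩
      rwa [← heq, Finset.erase_insert hwA]
    · have hlt : (g.V \ insert w A).card < n := by
        rw [← hn]
        refine Finset.card_lt_card ⟨Finset.sdiff_subset_sdiff le_rfl (Finset.subset_insert w A),
          fun h => ?_⟩
        have := h (Finset.mem_sdiff.2 ⟨hwV, hwA⟩)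
        simp at this
      obtain ⟨u, huV, huA, huc⟩ := ih _ hlt (hsub.ssubset_of_ne heq) hwc rfl
      exact ⟨u, huV, fun h => huA (Finset.mem_insert_of_mem h), huc⟩

/-- If `w` is not a cut vertex and `e'` joins it to a different vertex, any other edge at `w`
can be removed. -/
theorem ConnectedOn.connected_removeEdge {g : DLG L} {w : ℕ} (hw : g.ConnectedOn (g.V.erase w))
    {e e' : ℕ × ℕ} (he : e.1 = w ∨ e.2 = w) (he' : e' ∈ g.E) (hne : e' ≠ e)
    (hinc : e'.1 = w ∨ e'.2 = w) (hloop : e' ≠ (w, w)) : (g.removeEdge e).Connected := by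
  have lift : ∀ x ∈ g.V.erase w, ∀ y ∈ g.V.erase w,
      Relation.ReflTransGen (g.removeEdge e).adj x y := by
    intro x hx y hy
    refine Relation.ReflTransGen.mono ?_ _ _ (hw x hx y hy)
    rintro p q ⟨hpq, hp, hq⟩
    have hp' := (Finset.mem_erase.1 hp).1
    have hq' := (Finset.mem_erase.1 hq).1
    refine hpq.imp (fun h => Finset.mem_erase.2 ⟨?_, h⟩) (fun h => Finset.mem_erase.2 ⟨?_, h⟩) <;>
    · rintro rfl
      simp_all
  obtain ⟨x, hx, hwx⟩ : ∃ x ∈ g.V.erase w, (g.removeEdge e).adj w x := by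
    have hmem : e' ∈ (g.removeEdge e).E := Finset.mem_erase.2 ⟨hne, he'⟩
    obtain ⟨p, q⟩ := e'
    rcases hinc with h | h <;> simp only at h <;> subst h
    · exact ⟨q, Finset.mem_erase.2 ⟨fun h => hloop (by rw [h]), (g.edge_mem _ he').2⟩, .inl hmem⟩
    · exact ⟨p, Finset.mem_erase.2 ⟨fun h => hloop (by rw [h]), (g.edge_mem _ he').1⟩, .inr hmem⟩
  intro p hp q hq
  by_cases hpw : p = w <;> by_cases hqw : q = w
  · rw [hpw, hqw]
  · subst hpw
    exact .head hwx (lift x hx q (Finset.mem_erase.2 ⟨hqw, hq⟩))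
  · subst hqw
    exact (lift p (Finset.mem_erase.2 ⟨hpw, hp⟩) x hx).tail (adj_symm hwx)
  · exact lift p (Finset.mem_erase.2 ⟨hpw, hp⟩) q (Finset.mem_erase.2 ⟨hqw, hq⟩)

theorem finite_setOf_fields_eq (V : Finset ℕ) (E : Finset (ℕ × ℕ)) (lv : ℕ → L)
    (le : ℕ × ℕ → L) : {g : DLG L | g.V = V ∧ g.E = E ∧ g.lv = lv ∧ g.le = le}.Finite := by
  refine Set.Subsingleton.finite ?_
  rintro ⟨⟩ ⟨rfl, rfl, rfl, rfl⟩ ⟨⟩ ⟨rfl, rfl, rfl, rfl⟩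
  rfl

variable [PartialOrder L]

/-- The image of a connected graph under a subsumption mapping induces a connected subgraph. -/
theorem SubsPOWith.connectedOn_image {g₁ g₂ : DLG L} {m : ℕ → ℕ} (h : SubsPOWith g₁ g₂ m)
    (h₁ : g₁.Connected) : g₂.ConnectedOn (g₁.V.image m) := by
  intro x hx y hy
  obtain ⟨v, hv, rfl⟩ := Finset.mem_image.1 hx
  obtain ⟨w, hw, rfl⟩ := Finset.mem_image.1 hy
  refine (h₁ v hv w hw).lift m fun a b hab => ?_
  rcases hab with hab | hab
  · exact ⟨.inl (h.2.1 _ hab), Finset.mem_image_of_mem m (g₁.edge_mem _ hab).1,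
      Finset.mem_image_of_mem m (g₁.edge_mem _ hab).2⟩
  · exact ⟨.inr (h.2.1 _ hab), Finset.mem_image_of_mem m (g₁.edge_mem _ hab).2,
      Finset.mem_image_of_mem m (g₁.edge_mem _ hab).1⟩

theorem SubsPOWith.removeEdge {g₁ g₂ : DLG L} {m : ℕ → ℕ} (h : SubsPOWith g₁ g₂ m)
    {e : ℕ × ℕ} (he : ∀ e' ∈ g₁.E, (m e'.1, m e'.2) ≠ e) :
    SubsPOWith g₁ (g₂.removeEdge e) m :=
  ⟨h.1, fun e' he' => Finset.mem_erase.2 ⟨he e' he', h.2.1 e' he'⟩, h.2.2.1, h.2.2.2⟩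

/-- A spanning connected image keeps the graph connected when an edge outside it is removed. -/
theorem SubsPOWith.connected_of_image_eq {g₁ g₂ : DLG L} {m : ℕ → ℕ} (h : SubsPOWith g₁ g₂ m)
    (h₁ : g₁.Connected) (hV : g₁.V.image m = g₂.V) : g₂.Connected := by
  intro x hx y hy
  rw [← hV] at hx hy
  exact Relation.ReflTransGen.mono (fun _ _ h => h.1) _ _ (h.connectedOn_image h₁ x hx y hy)

/-- A surjective subsumption mapping under object identity that preserves labels can be
inverted. -/
theorem OI.subsPOOI_of_surjective {g₁ g₂ : DLG L} {m : ℕ → ℕ} (hm : OI g₁ m)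
    (hV : ∀ v ∈ g₂.V, ∃ u ∈ g₁.V, m u = v ∧ g₂.lv v ≤ g₁.lv u)
    (hE : ∀ e ∈ g₂.E, ∃ d ∈ g₁.E, (m d.1, m d.2) = e ∧ g₂.le e ≤ g₁.le d) :
    SubsPOOI g₂ g₁ := by
  have hinj : ∀ a ∈ g₁.V, ∀ b ∈ g₁.V, m a = m b → a = b := fun a ha b hb hab => by
    by_contra hne
    exact hm a ha b hb hne hab
  choose! k hk using hV
  have hkm : ∀ u ∈ g₁.V, m u ∈ g₂.V → k (m u) = u := fun u hu hmu =>
    hinj _ (hk _ hmu).1 _ hu (hk _ hmu).2.1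
  have hkE : ∀ e ∈ g₂.E, (k e.1, k e.2) ∈ g₁.E ∧ g₂.le e ≤ g₁.le (k e.1, k e.2) := by
    intro e he
    obtain ⟨⟨p, q⟩, hd, rfl, hle⟩ := hE e he
    have hmem := g₁.edge_mem _ hd
    have hmem₂ := g₂.edge_mem _ he
    simp only at hmem hmem₂ hle ⊢
    rw [hkm p hmem.1 hmem₂.1, hkm q hmem.2 hmem₂.2]
    exact ⟨hd, hle⟩
  refine ⟨k, ⟨fun v hv => (hk v hv).1, fun e he => (hkE e he).1, fun v hv => (hk v hv).2.2,
    fun e he => (hkE e he).2⟩, fun v₁ h₁ v₂ h₂ hne heq => hne ?_⟩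
  rw [← (hk v₁ h₁).2.1, ← (hk v₂ h₂).2.1, heq]

theorem exists_le_covBy_of_lt [Finite L] {c a : L} (h : c < a) :
    ∃ b, c ≤ b ∧ b < a ∧ ¬ ∃ d, b < d ∧ d < a := by
  obtain ⟨b, hcb, hb⟩ := (Set.toFinite (Set.Iio a)).exists_le_maximal (show c ∈ Set.Iio a from h)
  exact ⟨b, hcb, hb.prop, fun ⟨d, hbd, hda⟩ => hb.not_gt hda hbd⟩

/-- A vertex label strictly above everything mapped to it can be generalized. -/
theorem SubsPOWith.exists_generalize_vertex [Finite L] (T : L) {g₁ g₂ : DLG L} {m : ℕ → ℕ}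
    (h : SubsPOWith g₁ g₂ m) {v : ℕ} (hv : v ∈ g₂.V) {c : L} (hc : c < g₂.lv v)
    (hu : ∀ u ∈ g₁.V, m u = v → g₁.lv u ≤ c) :
    ∃ g' ∈ gammaPO T g₂, g'.V = g₂.V ∧ g'.E = g₂.E ∧ SubsPOWith g₁ g' m := by
  obtain ⟨b, hcb, hba, hcov⟩ := exists_le_covBy_of_lt hc
  refine ⟨⟨g₂.V, g₂.E, Function.update g₂.lv v b, g₂.le, g₂.edge_mem⟩,
    .inl ⟨v, hv, b, hba, hcov, rfl, rfl, rfl, rfl⟩, rfl, rfl, h.1, h.2.1, fun u hu' => ?_,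
    h.2.2.2⟩
  by_cases huv : m u = v
  · simpa [huv] using (hu u hu' huv).trans hcb
  · simpa [huv] using h.2.2.1 u hu'

/-- An edge label strictly above everything mapped to it can be generalized. -/
theorem SubsPOWith.exists_generalize_edge [Finite L] (T : L) {g₁ g₂ : DLG L} {m : ℕ → ℕ}
    (h : SubsPOWith g₁ g₂ m) {e : ℕ × ℕ} (he : e ∈ g₂.E) {c : L} (hc : c < g₂.le e)
    (hd : ∀ d ∈ g₁.E, (m d.1, m d.2) = e → g₁.le d ≤ c) :
    ∃ g' ∈ gammaPO T g₂, g'.V = g₂.V ∧ g'.E = g₂.E ∧ SubsPOWith g₁ g' m := by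
  obtain ⟨b, hcb, hba, hcov⟩ := exists_le_covBy_of_lt hc
  refine ⟨⟨g₂.V, g₂.E, g₂.lv, Function.update g₂.le e b, g₂.edge_mem⟩,
    .inr (.inl ⟨e, he, b, hba, hcov, rfl, rfl, rfl, rfl⟩), rfl, rfl, h.1, h.2.1, h.2.2.1,
    fun d hd' => ?_⟩
  by_cases hde : (m d.1, m d.2) = e
  · simpa [hde] using (hd d hd' hde).trans hcb
  · simpa [hde] using h.2.2.2 d hd'

/-- When every element outside the image is labeled `T` and some vertex lies outside the image,
an edge or a vertex can be deleted. -/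
theorem SubsPOWith.exists_delete_of_vertex {T : L} {g₁ g₂ : DLG L} {m : ℕ → ℕ}
    (h : SubsPOWith g₁ g₂ m) (h₁ : g₁.Connected) (h₂ : g₂.Connected)
    (hTV : ∀ v ∈ g₂.V, v ∉ g₁.V.image m → g₂.lv v = T)
    (hTE : ∀ e ∈ g₂.E, (∀ d ∈ g₁.E, (m d.1, m d.2) ≠ e) → g₂.le e = T)
    (hV : g₁.V.image m ⊂ g₂.V) :
    ∃ g' ∈ gammaPO T g₂, g'.Connected ∧ SubsPOWith g₁ g' m := by
  obtain ⟨w, hwV, hw, hwc⟩ := h₂.exists_connectedOn_erase hV (h.connectedOn_image h₁)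
  have hout : ∀ e : ℕ × ℕ, e.1 = w ∨ e.2 = w → ∀ d ∈ g₁.E, (m d.1, m d.2) ≠ e := by
    rintro e he d hd rfl
    rcases he with rfl | rfl
    · exact hw (Finset.mem_image_of_mem m (g₁.edge_mem d hd).1)
    · exact hw (Finset.mem_image_of_mem m (g₁.edge_mem d hd).2)
  have hincT : ∀ e ∈ g₂.incident w, g₂.le e = T := fun e he =>
    hTE e (Finset.mem_filter.1 he).1 (hout e (Finset.mem_filter.1 he).2)
  have hdel : ∀ e ∈ g₂.incident w, ∀ e' ∈ g₂.incident w, e' ≠ e → e' ≠ (w, w) →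
      ∃ g' ∈ gammaPO T g₂, g'.Connected ∧ SubsPOWith g₁ g' m := by
    intro e he e' he' hne hloop
    have hmem := Finset.mem_filter.1 he
    have hmem' := Finset.mem_filter.1 he'
    have hconn := hwc.connected_removeEdge hmem.2 hmem'.1 hne hmem'.2 hloop
    exact ⟨g₂.removeEdge e,
      .inr (.inr (.inl ⟨e, hmem.1, hincT e he, fun hb => hb.2 hconn, rfl⟩)), hconn,
      h.removeEdge (hout e hmem.2)⟩
  by_cases hcard : (g₂.incident w).card ≤ 1
  · have hE : ∀ e ∈ g₂.E \ g₂.incident w, e.1 ∈ g₂.V.erase w ∧ e.2 ∈ g₂.V.erase w := by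
      intro e he
      have heE := (Finset.mem_sdiff.1 he).1
      have hni := (Finset.mem_sdiff.1 he).2
      simp only [incident, Finset.mem_filter, heE, true_and, not_or] at hni
      exact ⟨Finset.mem_erase.2 ⟨hni.1, (g₂.edge_mem e heE).1⟩,
        Finset.mem_erase.2 ⟨hni.2, (g₂.edge_mem e heE).2⟩⟩
    refine ⟨⟨g₂.V.erase w, g₂.E \ g₂.incident w, g₂.lv, g₂.le, hE⟩,
      .inr (.inr (.inr ⟨w, hwV, hTV w hwV hw, hcard, hincT, rfl, rfl, rfl, rfl⟩)), ?_, ?_, ?_,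
      h.2.2.1, h.2.2.2⟩
    · intro x hx y hy
      refine Relation.ReflTransGen.mono ?_ _ _ (hwc x hx y hy)
      rintro p q ⟨hpq, hp, hq⟩
      have hp' := (Finset.mem_erase.1 hp).1
      have hq' := (Finset.mem_erase.1 hq).1
      exact hpq.imp (fun h => by simp [incident, h, hp', hq'])
        (fun h => by simp [incident, h, hp', hq'])
    · exact fun v hv => Finset.mem_erase.2
        ⟨fun hvw => hw (hvw ▸ Finset.mem_image_of_mem m hv), h.1 v hv⟩
    · exact fun e he => Finset.mem_sdiff.2
        ⟨h.2.1 e he, fun hi => hout _ (Finset.mem_filter.1 hi).2 e he rfl⟩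
  · obtain ⟨a, ha, b, hb, hab⟩ := Finset.one_lt_card.1 (not_le.1 hcard)
    by_cases haw : a = (w, w)
    · exact hdel a ha b hb hab.symm fun hbw => hab (haw.trans hbw.symm)
    · exact hdel b hb a ha hab haw

/-- One upward refinement step towards a strictly more general connected graph. -/
theorem exists_mem_gammaPO_of_subsPOOI [Finite L] {T : L} (hT : ∀ a : L, T ≤ a) {g₁ g₂ : DLG L}
    (h₁ : g₁.Connected) (h₂ : g₂.Connected) (h : SubsPOOI g₁ g₂) (hn : ¬ SubsPOOI g₂ g₁) :
    ∃ g' ∈ gammaPO T g₂, g'.Connected ∧ SubsPOOI g₁ g' := by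
  obtain ⟨m, hm, hOI⟩ := h
  have hinj : ∀ a ∈ g₁.V, ∀ b ∈ g₁.V, m a = m b → a = b := fun a ha b hb hab => by
    by_contra hne
    exact hOI a ha b hb hne hab
  suffices ∃ g' ∈ gammaPO T g₂, g'.Connected ∧ SubsPOWith g₁ g' m by
    obtain ⟨g', hg', hc, hs⟩ := this
    exact ⟨g', hg', hc, m, hs, hOI⟩
  by_contra hno
  have hvertex : ∀ v ∈ g₂.V, ∀ c < g₂.lv v, ¬ ∀ u ∈ g₁.V, m u = v → g₁.lv u ≤ c := by
    intro v hv c hc hu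
    obtain ⟨g', hg', hV', hE', hs⟩ := hm.exists_generalize_vertex T hv hc hu
    exact hno ⟨g', hg', connected_of_V_eq_of_E_eq hV' hE' h₂, hs⟩
  have hedge : ∀ e ∈ g₂.E, ∀ c < g₂.le e, ¬ ∀ d ∈ g₁.E, (m d.1, m d.2) = e → g₁.le d ≤ c := by
    intro e he c hc hd
    obtain ⟨g', hg', hV', hE', hs⟩ := hm.exists_generalize_edge T he hc hd
    exact hno ⟨g', hg', connected_of_V_eq_of_E_eq hV' hE' h₂, hs⟩
  have hTV : ∀ v ∈ g₂.V, v ∉ g₁.V.image m → g₂.lv v = T := by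
    intro v hv hvi
    by_contra hne
    refine hvertex v hv T (lt_of_le_of_ne (hT _) (Ne.symm hne)) fun u hu huv => ?_
    exact absurd (huv ▸ Finset.mem_image_of_mem m hu) hvi
  have hTE : ∀ e ∈ g₂.E, (∀ d ∈ g₁.E, (m d.1, m d.2) ≠ e) → g₂.le e = T := by
    intro e he hei
    by_contra hne
    exact hedge e he T (lt_of_le_of_ne (hT _) (Ne.symm hne)) fun d hd hde => absurd hde (hei d hd)
  have hsub : g₁.V.image m ⊆ g₂.V := Finset.image_subset_iff.2 hm.1
  by_cases hV : g₁.V.image m = g₂.V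
  · refine hn (hOI.subsPOOI_of_surjective ?_ ?_)
    · intro v hv
      obtain ⟨u, hu, rfl⟩ := Finset.mem_image.1 (hV ▸ hv)
      refine ⟨u, hu, rfl, ?_⟩
      by_contra hlt
      refine hvertex _ hv (g₁.lv u) (lt_of_le_not_ge (hm.2.2.1 u hu) hlt) fun u' hu' heq => ?_
      rw [hinj u' hu' u hu heq]
    · intro e he
      by_cases hei : ∃ d ∈ g₁.E, (m d.1, m d.2) = e
      · obtain ⟨d, hd, rfl⟩ := hei
        refine ⟨d, hd, rfl, ?_⟩
        by_contra hlt
        refine hedge _ he (g₁.le d) (lt_of_le_not_ge (hm.2.2.2 d hd) hlt) fun d' hd' heq => ?_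
        obtain ⟨heq₁, heq₂⟩ := Prod.mk.inj heq
        rw [Prod.ext (hinj _ (g₁.edge_mem d' hd').1 _ (g₁.edge_mem d hd).1 heq₁)
          (hinj _ (g₁.edge_mem d' hd').2 _ (g₁.edge_mem d hd).2 heq₂)]
      · push Not at hei
        have hs := hm.removeEdge hei
        have hc := hs.connected_of_image_eq h₁ hV
        exact absurd ⟨g₂.removeEdge e,
          .inr (.inr (.inl ⟨e, he, hTE e he hei, fun hb => hb.2 hc, rfl⟩)), hc, hs⟩ hno
  · exact hno (hm.exists_delete_of_vertex h₁ h₂ hTV hTE (hsub.ssubset_of_ne hV))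

/-- The number of labels strictly more general than `a`, plus one. -/
noncomputable def labelSize (a : L) : ℕ := (Set.Iio a).ncard + 1

theorem labelSize_strictMono [Finite L] : StrictMono (labelSize (L := L)) := fun _ _ h =>
  Nat.succ_lt_succ (Set.ncard_lt_ncard (Set.Iio_ssubset_Iio h))

/-- The total size of a graph, counting every vertex and edge with the size of its label. -/
noncomputable def size (g : DLG L) : ℕ :=
  ∑ v ∈ g.V, labelSize (g.lv v) + ∑ e ∈ g.E, labelSize (g.le e)

theorem SubsPOOI.size_le [Finite L] {g₁ g₂ : DLG L} (h : SubsPOOI g₁ g₂) :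
    g₁.size ≤ g₂.size := by
  obtain ⟨m, hm, hOI⟩ := h
  have hinj : ∀ a ∈ g₁.V, ∀ b ∈ g₁.V, m a = m b → a = b := fun a ha b hb hab => by
    by_contra hne
    exact hOI a ha b hb hne hab
  have hinjE : Set.InjOn (fun e : ℕ × ℕ => (m e.1, m e.2)) g₁.E := by
    intro d hd d' hd' heq
    obtain ⟨heq₁, heq₂⟩ := Prod.mk.inj heq
    exact Prod.ext (hinj _ (g₁.edge_mem d hd).1 _ (g₁.edge_mem d' hd').1 heq₁)
      (hinj _ (g₁.edge_mem d hd).2 _ (g₁.edge_mem d' hd').2 heq₂)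
  refine Nat.add_le_add ?_ ?_
  · calc ∑ v ∈ g₁.V, labelSize (g₁.lv v)
        ≤ ∑ v ∈ g₁.V, labelSize (g₂.lv (m v)) :=
          Finset.sum_le_sum fun v hv => labelSize_strictMono.monotone (hm.2.2.1 v hv)
      _ = ∑ v ∈ g₁.V.image m, labelSize (g₂.lv v) :=
          (Finset.sum_image (f := fun v => labelSize (g₂.lv v))
            fun a ha b hb hab => hinj a ha b hb hab).symm
      _ ≤ ∑ v ∈ g₂.V, labelSize (g₂.lv v) :=
          Finset.sum_le_sum_of_subset (Finset.image_subset_iff.2 hm.1)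
  · calc ∑ e ∈ g₁.E, labelSize (g₁.le e)
        ≤ ∑ e ∈ g₁.E, labelSize (g₂.le (m e.1, m e.2)) :=
          Finset.sum_le_sum fun e he => labelSize_strictMono.monotone (hm.2.2.2 e he)
      _ = ∑ e ∈ g₁.E.image fun e => (m e.1, m e.2), labelSize (g₂.le e) :=
          (Finset.sum_image (f := fun e => labelSize (g₂.le e)) hinjE).symm
      _ ≤ ∑ e ∈ g₂.E, labelSize (g₂.le e) :=
          Finset.sum_le_sum_of_subset (Finset.image_subset_iff.2 hm.2.1)

theorem sum_labelSize_update_lt [Finite L] {α : Type*} [DecidableEq α] {s : Finset α} {f : α → L}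
    {a : α} (ha : a ∈ s) {b : L} (hb : b < f a) :
    ∑ x ∈ s, labelSize (Function.update f a b x) < ∑ x ∈ s, labelSize (f x) := by
  refine Finset.sum_lt_sum (fun x _ => labelSize_strictMono.monotone ?_)
    ⟨a, ha, labelSize_strictMono (by simpa using hb)⟩
  by_cases hx : x = a
  · subst hx
    simpa using hb.le
  · simp [hx]

theorem sum_labelSize_erase_lt {α : Type*} [DecidableEq α] {s : Finset α} {a : α} (ha : a ∈ s)
    (f : α → L) : ∑ x ∈ s.erase a, labelSize (f x) < ∑ x ∈ s, labelSize (f x) := by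
  rw [← Finset.add_sum_erase s _ ha]
  exact Nat.lt_add_of_pos_left (Nat.succ_pos _)

theorem size_lt_of_mem_gammaPO [Finite L] {T : L} {g g' : DLG L} (h : g' ∈ gammaPO T g) :
    g'.size < g.size := by
  unfold size
  rcases h with ⟨v, hv, b, hb, -, hV, hE, hlv, hle⟩ | ⟨e, he, b, hb, -, hV, hE, hlv, hle⟩ |
    ⟨e, he, -, -, rfl⟩ | ⟨v, hv, -, -, -, hV, hE, hlv, hle⟩
  · rw [hV, hE, hlv, hle]
    exact Nat.add_lt_add_right (sum_labelSize_update_lt hv hb) _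
  · rw [hV, hE, hlv, hle]
    exact Nat.add_lt_add_left (sum_labelSize_update_lt he hb) _
  · exact Nat.add_lt_add_left (sum_labelSize_erase_lt he g.le) _
  · rw [hV, hE, hlv, hle]
    exact Nat.add_lt_add_of_lt_of_le (sum_labelSize_erase_lt hv g.lv)
      (Finset.sum_le_sum_of_subset Finset.sdiff_subset)

/-- Every connected specialization of a connected graph is refined upwards to an equivalent of
that graph. -/
theorem exists_reflTransGen_gammaPO [Finite L] {T : L} (hT : ∀ a : L, T ≤ a) {g₁ g₂ : DLG L}
    (h₁ : g₁.Connected) (h₂ : g₂.Connected) (h : SubsPOOI g₁ g₂) :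
    ∃ k : DLG L, Relation.ReflTransGen (fun x y => y ∈ gammaPO T x) g₂ k ∧
      SubsPOOI k g₁ ∧ SubsPOOI g₁ k := by
  induction hn : g₂.size using Nat.strong_induction_on generalizing g₂ with
  | _ n ih =>
    by_cases hrev : SubsPOOI g₂ g₁
    · exact ⟨g₂, .refl, hrev, h⟩
    · obtain ⟨g', hg', hc, hs⟩ := exists_mem_gammaPO_of_subsPOOI hT h₁ h₂ h hrev
      obtain ⟨k, hk, hkg⟩ := ih _ (hn ▸ size_lt_of_mem_gammaPO hg') hc hs rfl
      exact ⟨k, .head hg' hk, hkg⟩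

theorem finite_gammaPO [Finite L] (T : L) (g : DLG L) : (gammaPO T g).Finite := by
  have hvertex : (⋃ v ∈ g.V, ⋃ b : L, {g' : DLG L | g'.V = g.V ∧ g'.E = g.E ∧
      g'.lv = Function.update g.lv v b ∧ g'.le = g.le}).Finite :=
    g.V.finite_toSet.biUnion fun _ _ => Set.finite_iUnion fun _ => finite_setOf_fields_eq _ _ _ _
  have hedge : (⋃ e ∈ g.E, ⋃ b : L, {g' : DLG L | g'.V = g.V ∧ g'.E = g.E ∧
      g'.lv = g.lv ∧ g'.le = Function.update g.le e b}).Finite :=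
    g.E.finite_toSet.biUnion fun _ _ => Set.finite_iUnion fun _ => finite_setOf_fields_eq _ _ _ _
  have hdelE : (g.removeEdge '' g.E).Finite := g.E.finite_toSet.image _
  have hdelV : (⋃ v ∈ g.V, {g' : DLG L | g'.V = g.V.erase v ∧ g'.E = g.E \ g.incident v ∧
      g'.lv = g.lv ∧ g'.le = g.le}).Finite :=
    g.V.finite_toSet.biUnion fun _ _ => finite_setOf_fields_eq _ _ _ _
  refine (hvertex.union (hedge.union (hdelE.union hdelV))).subset ?_
  rintro g' (⟨v, hv, b, -, -, h⟩ | ⟨e, he, b, -, -, h⟩ | ⟨e, he, -, -, rfl⟩ | ⟨v, hv, -, -, -, h⟩)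
  · exact .inl (Set.mem_biUnion hv (Set.mem_iUnion.2 ⟨b, h⟩))
  · exact .inr (.inl (Set.mem_biUnion he (Set.mem_iUnion.2 ⟨b, h⟩)))
  · exact .inr (.inr (.inl ⟨e, he, rfl⟩))
  · exact .inr (.inr (.inr (Set.mem_biUnion hv h)))

end DLG

theorem gammaPO_ideal_under_OI {L : Type} [Fintype L] [PartialOrder L] (T : L) (hT : ∀ a : L, T ≤ a) :
    -- locally finite
    (∀ g : DLG L, g.Connected → (DLG.gammaPO T g).Finite) ∧
    -- complete: if g₁ strictly subsumes g₂, a finite chain of upward refinements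
    -- starting at g₂ reaches a graph equivalent to g₁
    (∀ g₁ g₂ : DLG L, g₁.Connected → g₂.Connected →
      DLG.SubsPOOI g₁ g₂ → ¬ DLG.SubsPOOI g₂ g₁ →
      ∃ h : DLG L, Relation.ReflTransGen (fun x y => y ∈ DLG.gammaPO T x) g₂ h ∧
        DLG.SubsPOOI h g₁ ∧ DLG.SubsPOOI g₁ h) ∧
    -- proper: no refinement of g is equivalent to g
    (∀ g : DLG L, g.Connected → ∀ g' ∈ DLG.gammaPO T g,
      ¬ (DLG.SubsPOOI g g' ∧ DLG.SubsPOOI g' g)) := by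
  refine ⟨fun g _ => DLG.finite_gammaPO T g, fun g₁ g₂ h₁ h₂ h _ =>
    DLG.exists_reflTransGen_gammaPO hT h₁ h₂ h, fun g _ g' hg' h => ?_⟩
  exact (DLG.size_lt_of_mem_gammaPO hg').not_ge h.1.size_le
end

section
/- Let g₁ = ⟨V₁, E₁, l₁⟩ and g₂ = ⟨V₂, E₂, l₂⟩ be connected directed labeled graphs with g₁ ⊑ g₂ witnessed by a mapping m, and let Δ_v = V₂ \ C_v and Δ_e = E₂ \ C_e be the vertex and edge deltas. If Δ_v ≠ ∅, then either there exists a vertex v ∈ Δ_v that is a leaf of g₂ (incident to at most one edge of g₂), or there exists an edge e ∈ Δ_e that is not a bridge of g₂. -/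
namespace DLG

theorem adj_symm_s17 {L : Type} (g : DLG L) : Std.Symm g.adj :=
  ⟨fun _ _ h => h.symm⟩

theorem reach_symm {L : Type} (g : DLG L) {a b : ℕ}
    (h : Relation.ReflTransGen g.adj a b) : Relation.ReflTransGen g.adj b a :=
  have := g.adj_symm_s17
  Relation.ReflTransGen.stdSymm.symm _ _ h

/-- An edge whose endpoints remain joined after its removal is not a bridge. -/
theorem not_isBridge_of_reach {L : Type} {g : DLG L} (hg : g.Connected) {e : ℕ × ℕ}
    (he : Relation.ReflTransGen (g.removeEdge e).adj e.1 e.2) : ¬ g.IsBridge e := by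
  rintro ⟨-, hdis⟩
  refine hdis fun x hx y hy => ?_
  have key : ∀ a b, (a, b) ∈ g.E → Relation.ReflTransGen (g.removeEdge e).adj a b := by
    intro a b hab
    by_cases h : (a, b) = e
    · subst h; exact he
    · exact .single (Or.inl (Finset.mem_erase.2 ⟨h, hab⟩))
  have hxy := hg x hx y hy
  clear hx hy
  induction hxy with
  | refl => exact .refl
  | tail _ hbc ih =>
    rcases hbc with h | h
    · exact ih.trans (key _ _ h)
    · exact ih.trans (reach_symm _ (key _ _ h))

/-- A proper, internally connected vertex set of a connected graph avoids some vertex whose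
deletion leaves all the other vertices joined. -/
theorem exists_noncut_vertex {L : Type} {g : DLG L} (hg : g.Connected) {r : ℕ}
    (S : Finset ℕ) (hr : r ∈ S) (hS : S ⊂ g.V)
    (hconn : ∀ x ∈ S,
      Relation.ReflTransGen (fun a b => g.adj a b ∧ a ∈ S ∧ b ∈ S) r x) :
    ∃ v ∈ g.V, v ∉ S ∧ ∀ x ∈ g.V, x ≠ v →
      Relation.ReflTransGen (fun a b => g.adj a b ∧ a ≠ v ∧ b ≠ v) r x := by
  obtain ⟨z, hz, hzS⟩ := Finset.exists_of_ssubset hS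
  have hcross : ∃ a b, a ∈ S ∧ b ∉ S ∧ g.adj a b := by
    by_contra! hno
    have hrz := hg r (hS.1 hr) z hz
    refine hzS ?_
    clear hz hzS
    induction hrz with
    | refl => exact hr
    | tail _ hbc ih =>
      by_contra hc
      exact hno _ _ ih hc hbc
  obtain ⟨a, b, ha, hb, hab⟩ := hcross
  have hbV : b ∈ g.V := by
    rcases hab with h | h
    · exact (g.edge_mem _ h).2
    · exact (g.edge_mem _ h).1
  by_cases hfull : insert b S = g.V
  · refine ⟨b, hbV, hb, fun x hx hxb => ?_⟩
    rw [← hfull] at hx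
    refine Relation.ReflTransGen.mono ?_ _ _ (hconn x (Finset.mem_of_mem_insert_of_ne hx hxb))
    rintro c d ⟨h, hc, hd⟩
    exact ⟨h, fun h' => hb (h' ▸ hc), fun h' => hb (h' ▸ hd)⟩
  · have hsub : insert b S ⊂ g.V :=
      (Finset.insert_subset hbV hS.1).ssubset_of_ne hfull
    have hmono : ∀ x ∈ S, Relation.ReflTransGen
        (fun c d => g.adj c d ∧ c ∈ insert b S ∧ d ∈ insert b S) r x := fun x hx =>
      Relation.ReflTransGen.mono (fun c d ⟨h, hc, hd⟩ =>
        ⟨h, Finset.mem_insert_of_mem hc, Finset.mem_insert_of_mem hd⟩) _ _ (hconn x hx)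
    obtain ⟨v, hv, hvS, hreach⟩ := exists_noncut_vertex hg (insert b S)
      (Finset.mem_insert_of_mem hr) hsub (by
        intro x hx
        rcases Finset.mem_insert.1 hx with rfl | hx
        · exact (hmono a ha).tail
            ⟨hab, Finset.mem_insert_of_mem ha, Finset.mem_insert_self _ _⟩
        · exact hmono x hx)
    exact ⟨v, hv, fun h => hvS (Finset.mem_insert_of_mem h), hreach⟩
termination_by (g.V \ S).card
decreasing_by
  refine Finset.card_lt_card ((Finset.ssubset_iff_of_subset ?_).2 ⟨b, ?_, ?_⟩)
  · exact Finset.sdiff_subset_sdiff subset_rfl (Finset.subset_insert _ _)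
  · exact Finset.mem_sdiff.2 ⟨hbV, hb⟩
  · simp

/-- A non-cut vertex with at least two incident edges lies on a non-bridge. -/
theorem exists_incident_not_isBridge {L : Type} {g : DLG L} (hg : g.Connected) {r v : ℕ}
    (hreach : ∀ x ∈ g.V, x ≠ v →
      Relation.ReflTransGen (fun a b => g.adj a b ∧ a ≠ v ∧ b ≠ v) r x)
    (hcard : 1 < (g.incident v).card) :
    ∃ e ∈ g.incident v, ¬ g.IsBridge e := by
  obtain ⟨e, he, f, hf, hef⟩ := Finset.one_lt_card.1 hcard
  obtain ⟨heE, hev⟩ := Finset.mem_filter.1 he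
  obtain ⟨hfE, hfv⟩ := Finset.mem_filter.1 hf
  by_cases hloop : f.1 = f.2
  · refine ⟨f, hf, not_isBridge_of_reach hg ?_⟩
    rw [hloop]
  refine ⟨e, he, not_isBridge_of_reach hg ?_⟩
  have hne : ∀ x ∈ g.V, x ≠ v → Relation.ReflTransGen (g.removeEdge e).adj r x := by
    intro x hx hxv
    refine Relation.ReflTransGen.mono ?_ _ _ (hreach x hx hxv)
    rintro a b ⟨hab, ha, hb⟩
    refine hab.imp (fun h => Finset.mem_erase.2 ⟨?_, h⟩)
      (fun h => Finset.mem_erase.2 ⟨?_, h⟩)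
    all_goals
      rintro rfl
      simp_all
  have hfe : f ∈ (g.removeEdge e).E := Finset.mem_erase.2 ⟨hef.symm, hfE⟩
  have hv : Relation.ReflTransGen (g.removeEdge e).adj r v := by
    rcases hfv with h | h
    · subst h
      exact (hne f.2 (g.edge_mem f hfE).2 (Ne.symm hloop)).tail (Or.inr hfe)
    · subst h
      exact (hne f.1 (g.edge_mem f hfE).1 hloop).tail (Or.inl hfe)
  have hall : ∀ x ∈ g.V, Relation.ReflTransGen (g.removeEdge e).adj r x := by
    intro x hx
    by_cases h : x = v
    · exact h ▸ hv
    · exact hne x hx h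
  exact (reach_symm _ (hall _ (g.edge_mem e heE).1)).trans (hall _ (g.edge_mem e heE).2)

/-- The image of a connected graph under an edge-preserving map is internally connected. -/
theorem Connected.reach_image {L : Type} {g₁ g₂ : DLG L} {m : ℕ → ℕ} (hc : g₁.Connected)
    (hE : ∀ e ∈ g₁.E, (m e.1, m e.2) ∈ g₂.E) {r : ℕ} (hr : r ∈ g₁.V) :
    ∀ x ∈ g₁.V.image m, Relation.ReflTransGen
      (fun a b => g₂.adj a b ∧ a ∈ g₁.V.image m ∧ b ∈ g₁.V.image m) (m r) x := by
  intro x hx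
  obtain ⟨w, hw, rfl⟩ := Finset.mem_image.1 hx
  refine (hc r hr w hw).lift m fun a b hab => ?_
  rcases hab with h | h
  · exact ⟨Or.inl (hE _ h), Finset.mem_image_of_mem m (g₁.edge_mem _ h).1,
      Finset.mem_image_of_mem m (g₁.edge_mem _ h).2⟩
  · exact ⟨Or.inr (hE _ h), Finset.mem_image_of_mem m (g₁.edge_mem _ h).2,
      Finset.mem_image_of_mem m (g₁.edge_mem _ h).1⟩

end DLG

theorem delta_has_leaf_or_nonbridge {L : Type} [Fintype L] (g₁ g₂ : DLG L)
    (m : ℕ → ℕ) (hm : DLG.SubsWith g₁ g₂ m)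
    (hc₁ : g₁.Connected) (hc₂ : g₂.Connected)
    (hΔ : g₂.V \ g₁.V.image m ≠ ∅) :
    (∃ v ∈ g₂.V \ g₁.V.image m, (g₂.incident v).card ≤ 1) ∨
    (∃ e ∈ g₂.E \ g₁.E.image (fun e => (m e.1, m e.2)), ¬ g₂.IsBridge e) := by
  obtain ⟨hmV, hmE, -, -⟩ := hm
  obtain ⟨z, hz⟩ := Finset.nonempty_iff_ne_empty.2 hΔ
  obtain ⟨hzV, hzC⟩ := Finset.mem_sdiff.1 hz
  have of_noncut : ∀ r, ∀ v ∈ g₂.V, v ∉ g₁.V.image m → (∀ x ∈ g₂.V, x ≠ v →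
      Relation.ReflTransGen (fun a b => g₂.adj a b ∧ a ≠ v ∧ b ≠ v) r x) →
      (∃ v ∈ g₂.V \ g₁.V.image m, (g₂.incident v).card ≤ 1) ∨
      (∃ e ∈ g₂.E \ g₁.E.image (fun e => (m e.1, m e.2)), ¬ g₂.IsBridge e) := by
    intro r v hv hvC hreach
    rcases Nat.lt_or_ge 1 (g₂.incident v).card with hcard | hcard
    · obtain ⟨e, he, hbr⟩ := DLG.exists_incident_not_isBridge hc₂ hreach hcard
      obtain ⟨heE, hev⟩ := Finset.mem_filter.1 he
      refine Or.inr ⟨e, Finset.mem_sdiff.2 ⟨heE, fun heC => hvC ?_⟩, hbr⟩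
      obtain ⟨f, hf, rfl⟩ := Finset.mem_image.1 heC
      rcases hev with rfl | rfl
      · exact Finset.mem_image_of_mem m (g₁.edge_mem f hf).1
      · exact Finset.mem_image_of_mem m (g₁.edge_mem f hf).2
    · exact Or.inl ⟨v, Finset.mem_sdiff.2 ⟨hv, hvC⟩, hcard⟩
  rcases g₁.V.eq_empty_or_nonempty with hemp | ⟨r, hr⟩
  · by_cases hsing : {z} = g₂.V
    · refine of_noncut z z hzV hzC fun x hx hxz => absurd ?_ hxz
      rw [← hsing] at hx
      exact Finset.mem_singleton.1 hx
    · obtain ⟨v, hv, -, hreach⟩ := DLG.exists_noncut_vertex hc₂ (r := z) {z}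
        (Finset.mem_singleton_self z)
        ((Finset.singleton_subset_iff.2 hzV).ssubset_of_ne hsing)
        (fun x hx => by rw [Finset.mem_singleton.1 hx])
      exact of_noncut z v hv (by simp [hemp]) hreach
  · have hsub : g₁.V.image m ⊆ g₂.V := Finset.image_subset_iff.2 hmV
    obtain ⟨v, hv, hvC, hreach⟩ := DLG.exists_noncut_vertex hc₂ (g₁.V.image m)
      (Finset.mem_image_of_mem m hr)
      ((Finset.ssubset_iff_of_subset hsub).2 ⟨z, hzV, hzC⟩) (hc₁.reach_image hmE hr)
    exact of_noncut (m r) v hv hvC hreach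
end
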